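/- Let G = (N, E) be a finite connected simple graph with at least two nodes and chromatic number χ(G). Then the minimum, over all feasible families (OC_i)_{i ∈ N} of finite color sets, of the total number of colors |⋃_{i ∈ N} OC_i| equals Q(χ(G)). Equivalently, the minimum number of sub-bands admitting a feasible spectrum allocation under the duplexing constraint is Q(χ(G)). -/

import Mathlib

/-- `Qmin M` is the least positive integer `q` such that the central binomial
coefficient `C(q, ⌊q/2⌋)` is at least `M`. -/
noncomputable def Qmin (M : ℕ) : ℕ := sInf {q : ℕ | 0 < q ∧ M ≤ q.choose (q / 2)}

/-- The subsets of a finite set `s` split into chains, the labels `m A` naming the chain of `A`,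
such that the chain with label `L` meets exactly the levels from `#L` to `#s - #L`. -/
theorem Finset.exists_symmetric_chain_labelling {α : Type*} [DecidableEq α] (s : Finset α) :
    ∃ m : Finset α → Finset α,
      (∀ A ⊆ s, m A ⊆ s) ∧
      (∀ A ⊆ s, ∀ B ⊆ s, m A = m B → A ⊆ B ∨ B ⊆ A) ∧
      (∀ A ⊆ s, (m A).card ≤ A.card ∧ A.card + (m A).card ≤ s.card) ∧
      (∀ A ⊆ s, ∀ k, (m A).card ≤ k → k + (m A).card ≤ s.card →
        ∃ B ⊆ s, m B = m A ∧ B.card = k) := by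
  induction s using Finset.induction_on with
  | empty =>
    refine ⟨id, fun A h => h, fun A _ B _ h => Or.inl h.subset, fun A h => ?_, fun A h k _ hk => ?_⟩
    · simp [Finset.subset_empty.1 h]
    · refine ⟨A, h, rfl, ?_⟩
      have := Finset.subset_empty.1 h
      simp_all
  | insert a s ha ih =>
    obtain ⟨m, hsub, hchain, hcard, hlevel⟩ := ih
    let m' : Finset α → Finset α := fun A =>
      if a ∈ A then
        if (A.erase a).card + (m (A.erase a)).card = s.card then m (A.erase a)
        else insert a (m (A.erase a))
      else m A
    have not_mem_label {A : Finset α} (hA : A ⊆ s) : a ∉ m A := fun h => ha (hsub A hA h)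
    have label_old {A : Finset α} (hA : A ⊆ s) : m' A = m A := if_neg fun h => ha (hA h)
    have label_top {A : Finset α} (hA : A ⊆ s) (h : A.card + (m A).card = s.card) :
        m' (insert a A) = m A := by
      simp [m', Finset.erase_insert fun h => ha (hA h), h]
    have label_low {A : Finset α} (hA : A ⊆ s) (h : A.card + (m A).card ≠ s.card) :
        m' (insert a A) = insert a (m A) := by
      simp [m', Finset.erase_insert fun h => ha (hA h), h]
    have card_ins {A : Finset α} (hA : A ⊆ s) : (insert a A).card = A.card + 1 :=
      Finset.card_insert_of_notMem fun h => ha (hA h)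
    have card_label {A : Finset α} (hA : A ⊆ s) : (insert a (m A)).card = (m A).card + 1 :=
      Finset.card_insert_of_notMem (not_mem_label hA)
    have card_s : (insert a s).card = s.card + 1 := Finset.card_insert_of_notMem ha
    have below_top {A B : Finset α} (hA : A ⊆ s) (hB : B ⊆ s)
        (h : B.card + (m B).card = s.card) (he : m A = m B) : A ⊆ insert a B := by
      refine Finset.Subset.trans ?_ (Finset.subset_insert a B)
      rcases hchain A hA B hB he with h1 | h1
      · exact h1
      · have := (hcard A hA).2
        rw [he] at this
        exact (Finset.eq_of_subset_of_card_le h1 (by omega)).symm.subset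
    have subset_cases {A : Finset α} (hA : A ⊆ insert a s) :
        A ⊆ s ∨ ∃ A₀ ⊆ s, A = insert a A₀ := by
      by_cases h : a ∈ A
      · exact Or.inr ⟨A.erase a, Finset.subset_insert_iff.1 hA, (Finset.insert_erase h).symm⟩
      · exact Or.inl ((Finset.subset_insert_iff_of_notMem h).1 hA)
    have level_old {A : Finset α} (hA : A ⊆ s) (k : ℕ) (hk : (m A).card ≤ k)
        (hk' : k + (m A).card ≤ s.card + 1) :
        ∃ B ⊆ insert a s, m' B = m A ∧ B.card = k := by
      have := hcard A hA
      by_cases hks : k + (m A).card ≤ s.card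
      · obtain ⟨B, hB, hm, hc⟩ := hlevel A hA k hk hks
        exact ⟨B, hB.trans (Finset.subset_insert a s), (label_old hB).trans hm, hc⟩
      · obtain ⟨B, hB, hm, hc⟩ := hlevel A hA (k - 1) (by omega) (by omega)
        refine ⟨insert a B, Finset.insert_subset_insert a hB, ?_, ?_⟩
        · rw [label_top hB (by rw [hm]; omega), hm]
        · rw [card_ins hB]; omega
    refine ⟨m', fun A hA' => ?_, fun A hA' B hB' he => ?_, fun A hA' => ?_, fun A hA' k hk hk' => ?_⟩
    · rcases subset_cases hA' with hA | ⟨A, hA, rfl⟩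
      · rw [label_old hA]
        exact (hsub A hA).trans (Finset.subset_insert a s)
      · by_cases h : A.card + (m A).card = s.card
        · rw [label_top hA h]
          exact (hsub A hA).trans (Finset.subset_insert a s)
        · rw [label_low hA h]
          exact Finset.insert_subset_insert a (hsub A hA)
    · rcases subset_cases hA' with hA | ⟨A, hA, rfl⟩ <;> rcases subset_cases hB' with hB | ⟨B, hB, rfl⟩
      · rw [label_old hA, label_old hB] at he
        exact hchain A hA B hB he
      · rw [label_old hA] at he
        by_cases h : B.card + (m B).card = s.card
        · rw [label_top hB h] at he
          exact Or.inl (below_top hA hB h he)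
        · rw [label_low hB h] at he
          exact absurd (he ▸ Finset.mem_insert_self a _) (not_mem_label hA)
      · rw [label_old hB] at he
        by_cases h : A.card + (m A).card = s.card
        · rw [label_top hA h] at he
          exact Or.inr (below_top hB hA h he.symm)
        · rw [label_low hA h] at he
          exact absurd (he ▸ Finset.mem_insert_self a _) (not_mem_label hB)
      · have key : m A = m B := by
          by_cases h : A.card + (m A).card = s.card <;> by_cases h' : B.card + (m B).card = s.card
          · rwa [label_top hA h, label_top hB h'] at he
          · rw [label_top hA h, label_low hB h'] at he
            exact absurd (he ▸ Finset.mem_insert_self a _) (not_mem_label hA)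
          · rw [label_low hA h, label_top hB h'] at he
            exact absurd (he ▸ Finset.mem_insert_self a _) (not_mem_label hB)
          · rw [label_low hA h, label_low hB h'] at he
            rw [← Finset.erase_insert (not_mem_label hA), he,
              Finset.erase_insert (not_mem_label hB)]
        exact (hchain A hA B hB key).imp (Finset.insert_subset_insert a)
          (Finset.insert_subset_insert a)
    · rcases subset_cases hA' with hA | ⟨A, hA, rfl⟩
      · have := hcard A hA
        rw [label_old hA, card_s]
        omega
      · have := hcard A hA
        by_cases h : A.card + (m A).card = s.card
        · rw [label_top hA h, card_s, card_ins hA]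
          omega
        · rw [label_low hA h, card_s, card_ins hA, card_label hA]
          omega
    · rw [card_s] at hk'
      rcases subset_cases hA' with hA | ⟨A, hA, rfl⟩
      · rw [label_old hA] at hk hk' ⊢
        exact level_old hA k hk hk'
      · by_cases h : A.card + (m A).card = s.card
        · rw [label_top hA h] at hk hk' ⊢
          exact level_old hA k hk hk'
        · rw [label_low hA h] at hk hk' ⊢
          rw [card_label hA] at hk hk'
          obtain ⟨B, hB, hm, hc⟩ := hlevel A hA (k - 1) (by omega) (by omega)
          refine ⟨insert a B, Finset.insert_subset_insert a hB, ?_, ?_⟩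
          · rw [label_low hB (by rw [hm]; omega), hm]
          · rw [card_ins hB]; omega

/-- A graph whose vertices carry subsets of `s`, incomparable along edges, is colorable with
as many colors as the middle level of the powerset of `s` has elements. -/
theorem SimpleGraph.colorable_choose_of_incomparable {V α : Type*} [DecidableEq α]
    (G : SimpleGraph V) (s : Finset α) (F : V → Finset α) (hF : ∀ i, F i ⊆ s)
    (hG : ∀ i j, G.Adj i j → ¬ F i ⊆ F j) : G.Colorable (s.card.choose (s.card / 2)) := by
  obtain ⟨m, -, hchain, hcard, hlevel⟩ := s.exists_symmetric_chain_labelling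
  let T := (s.powersetCard (s.card / 2)).image m
  have hT (i : V) : m (F i) ∈ T := by
    have := hcard _ (hF i)
    obtain ⟨B, hB, hm, hc⟩ := hlevel _ (hF i) (s.card / 2) (by omega) (by omega)
    exact Finset.mem_image.2 ⟨B, Finset.mem_powersetCard.2 ⟨hB, hc⟩, hm⟩
  let C : G.Coloring T := SimpleGraph.Coloring.mk (fun i => ⟨m (F i), hT i⟩) fun {i j} hij he =>
    (hchain _ (hF i) _ (hF j) (Subtype.ext_iff.1 he)).elim (hG i j hij) (hG j i hij.symm)
  refine C.colorable.mono ?_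
  rw [Fintype.card_coe, ← Finset.card_powersetCard]
  exact Finset.card_image_le

theorem Qmin_spec (M : ℕ) : 0 < Qmin M ∧ M ≤ (Qmin M).choose (Qmin M / 2) := by
  refine Nat.sInf_mem (s := {q : ℕ | 0 < q ∧ M ≤ q.choose (q / 2)}) ⟨M + 1, M.succ_pos, ?_⟩
  have := Nat.choose_le_middle 1 (M + 1)
  rw [Nat.choose_one_right] at this
  omega

/-- Let `G` be a finite connected simple graph with at least two nodes and
chromatic number `χ(G)`.  The minimum, over all feasible families `(OC i)` of finite color
sets (i.e. those satisfying (i) `OC i \ OC j ≠ ∅` for every ordered adjacent pair and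
(ii) `⋃_{j ~ i} (OC i \ OC j) = OC i` for every node), of the total number of colors
`|⋃ i, OC i|` equals `Qmin (χ(G))`: this is the minimum number of sub-bands admitting a
feasible spectrum allocation under the duplexing constraint. -/
theorem isLeast_feasible_family_card
    {V : Type*} [Fintype V] [DecidableEq V]
    (G : SimpleGraph V) [DecidableRel G.Adj]
    (hconn : G.Connected) (hcard : 1 < Fintype.card V) :
    IsLeast
      {n : ℕ | ∃ OC : V → Finset ℕ,
        (∀ i j : V, G.Adj i j → (OC i \ OC j).Nonempty) ∧
        (∀ i : V, (G.neighborFinset i).biUnion (fun j => OC i \ OC j) = OC i) ∧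
        (Finset.univ.biUnion OC).card = n}
      (Qmin G.chromaticNumber.toNat) := by
  have hfin : G.Colorable (Fintype.card V) := G.colorable_of_fintype
  have lower : ∀ OC : V → Finset ℕ, (∀ i j : V, G.Adj i j → (OC i \ OC j).Nonempty) →
      Qmin G.chromaticNumber.toNat ≤ (Finset.univ.biUnion OC).card := by
    intro OC h
    have : Nontrivial V := Fintype.one_lt_card_iff_nontrivial.1 hcard
    obtain ⟨v⟩ := hconn.nonempty
    obtain ⟨w, hvw⟩ := hconn.preconnected.exists_adj_of_nontrivial v
    obtain ⟨c, hc⟩ := h v w hvw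
    refine Nat.sInf_le ⟨Finset.card_pos.2
      ⟨c, Finset.mem_biUnion.2 ⟨v, Finset.mem_univ v, (Finset.mem_sdiff.1 hc).1⟩⟩, ?_⟩
    have hcol := G.colorable_choose_of_incomparable (Finset.univ.biUnion OC) OC
      (fun i => Finset.subset_biUnion_of_mem OC (Finset.mem_univ i))
      (fun i j hij => Finset.sdiff_nonempty.1 (h i j hij))
    exact ENat.toNat_le_of_le_natCast hcol.chromaticNumber_le
  refine ⟨?_, ?_⟩
  · set q := Qmin G.chromaticNumber.toNat
    let P := (Finset.range q).powersetCard (q / 2)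
    have hP : G.chromaticNumber.toNat ≤ Fintype.card P := by
      rw [Fintype.card_coe, Finset.card_powersetCard, Finset.card_range]
      exact (Qmin_spec _).2
    let C : G.Coloring P :=
      ((SimpleGraph.colorable_chromaticNumber hfin).mono hP).toColoring le_rfl
    let A : V → Finset ℕ := fun i => C i
    have hA (i : V) : A i ⊆ Finset.range q ∧ (A i).card = q / 2 :=
      Finset.mem_powersetCard.1 (C i).2
    have hne (i j : V) (hij : G.Adj i j) : (A i \ A j).Nonempty := by
      rw [Finset.sdiff_nonempty]
      intro hs
      exact C.valid hij (Subtype.ext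
        (Finset.eq_of_subset_of_card_le hs ((hA j).2.trans (hA i).2.symm).le))
    let OC : V → Finset ℕ := fun i => (G.neighborFinset i).biUnion fun j => A i \ A j
    have hOC (i : V) : OC i ⊆ A i :=
      Finset.biUnion_subset.2 fun j _ => Finset.sdiff_subset
    have hdiff (i j : V) (hij : G.Adj i j) : A i \ A j ⊆ OC i \ OC j := fun c hc =>
      Finset.mem_sdiff.2 ⟨Finset.mem_biUnion.2 ⟨j, (G.mem_neighborFinset i j).2 hij, hc⟩,
        fun h => (Finset.mem_sdiff.1 hc).2 (hOC j h)⟩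
    have hfeas (i j : V) (hij : G.Adj i j) : (OC i \ OC j).Nonempty :=
      (hne i j hij).mono (hdiff i j hij)
    refine ⟨OC, hfeas, fun i => ?_, le_antisymm ?_ (lower OC hfeas)⟩
    · refine (Finset.biUnion_subset.2 fun j _ => Finset.sdiff_subset).antisymm ?_
      exact Finset.biUnion_mono fun j hj => hdiff i j ((G.mem_neighborFinset i j).1 hj)
    · refine (Finset.card_le_card (Finset.biUnion_subset.2 fun i _ => (hOC i).trans (hA i).1)).trans
        (Finset.card_range q).le
  · rintro n ⟨OC, h, -, rfl⟩
    exact lower OC h
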